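/- Let h be a gauge function, let m be a positive integer, and let f : ℝ^n → [0,∞) be measurable, vanishing outside [0,1]^n, with f ≤ 2^{nm} h(2^{-nm}) almost everywhere, and suppose ∫_d f dV_n ≤ h(V_n(d)) for every dyadic cube d ∈ D_j with 0 ≤ j ≤ m. Then ∫_c f dV_n ≤ 3^n h(V_n(c)) for every cube c ⊂ ℝ^n; equivalently, 3^{-n} f satisfies condition (i) of membership in F_n(R,h). -/

import Mathlib

open MeasureTheory Set Filter Topology

/-- A gauge function: continuous, increasing on `[0,∞)`, vanishing at `0`, with
`(R1)` `h x / x` decreasing and `(R2)` `h x / x → ∞` as `x → 0+`. -/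
structure IsGauge (h : ℝ → ℝ) : Prop where
  continuousOn : ContinuousOn h (Set.Ici 0)
  mono : MonotoneOn h (Set.Ici 0)
  zero : h 0 = 0
  r1 : ∀ ⦃x y : ℝ⦄, 0 < x → x ≤ y → h y / y ≤ h x / x
  r2 : Filter.Tendsto (fun x => h x / x) (nhdsWithin 0 (Set.Ioi 0)) Filter.atTop

/-- A cube in `ℝ^n`: a product of closed intervals of a common positive length. -/
def IsCube {n : ℕ} (c : Set (Fin n → ℝ)) : Prop :=
  ∃ (a : Fin n → ℝ) (s : ℝ), 0 < s ∧ c = Set.univ.pi fun i => Set.Icc (a i) (a i + s)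

/-- The closed unit cube `[0,1]^n`. -/
def unitCube (n : ℕ) : Set (Fin n → ℝ) := Set.univ.pi fun _ => Set.Icc (0 : ℝ) 1

/-- A dyadic cube of generation `j` in `[0,1]^n`. -/
def IsDyadicCube {n : ℕ} (j : ℕ) (d : Set (Fin n → ℝ)) : Prop :=
  ∃ k : Fin n → ℕ, (∀ i, k i < 2 ^ j) ∧
    d = Set.univ.pi fun i => Set.Icc ((k i : ℝ) / 2 ^ j) (((k i : ℝ) + 1) / 2 ^ j)

/-- The volume of a cube of side length `s` in `ℝ^n` is `s ^ n`. -/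
theorem volume_pi_Icc_add {n : ℕ} (a : Fin n → ℝ) (s : ℝ) :
    volume (Set.univ.pi fun i => Set.Icc (a i) (a i + s)) = ENNReal.ofReal s ^ n := by
  rw [volume_pi_pi]
  simp

theorem measurableSet_pi_Icc {n : ℕ} (a b : Fin n → ℝ) :
    MeasurableSet (Set.univ.pi fun i => Set.Icc (a i) (b i)) :=
  MeasurableSet.univ_pi fun _ => measurableSet_Icc

theorem toReal_volume_pi_Icc_add {n : ℕ} (a : Fin n → ℝ) {s : ℝ} (hs : 0 ≤ s) :
    (volume (Set.univ.pi fun i => Set.Icc (a i) (a i + s))).toReal = s ^ n := by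
  rw [volume_pi_Icc_add, ENNReal.toReal_pow, ENNReal.toReal_ofReal hs]

theorem IsDyadicCube.measurableSet {n j : ℕ} {d : Set (Fin n → ℝ)} (hd : IsDyadicCube j d) :
    MeasurableSet d := by
  obtain ⟨k, -, rfl⟩ := hd
  exact measurableSet_pi_Icc _ _

theorem IsDyadicCube.toReal_volume {n j : ℕ} {d : Set (Fin n → ℝ)} (hd : IsDyadicCube j d) :
    (volume d).toReal = (((2 : ℝ) ^ j)⁻¹) ^ n := by
  obtain ⟨k, -, rfl⟩ := hd
  simp_rw [add_div, one_div]
  exact toReal_volume_pi_Icc_add _ (by positivity)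

theorem isDyadicCube_unitCube (n : ℕ) : IsDyadicCube 0 (unitCube n) :=
  ⟨fun _ => 0, by simp, by simp [unitCube]⟩

/-- Only the part of the domain of integration inside the support matters. -/
theorem setLIntegral_mono_of_inter_subset {α : Type*} [MeasurableSpace α] {μ : Measure α}
    {f : α → ENNReal} {s t u : Set α} (hs : MeasurableSet s) (ht : MeasurableSet t)
    (hf : ∀ x ∉ u, f x = 0) (hst : s ∩ u ⊆ t) :
    ∫⁻ x in s, f x ∂μ ≤ ∫⁻ x in t, f x ∂μ := by
  rw [← lintegral_indicator hs, ← lintegral_indicator ht]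
  refine lintegral_mono fun x => ?_
  by_cases hx : x ∈ u
  · by_cases hxs : x ∈ s
    · rw [Set.indicator_of_mem hxs, Set.indicator_of_mem (hst ⟨hxs, hx⟩)]
    · simp [hxs]
  · simp [Set.indicator_apply_eq_zero.mpr fun _ => hf x hx]

/-- A side length in `[2^{-m}, 1)` lies in `[2^{-j}, 2 · 2^{-j})` for some `j ≤ m`. -/
theorem exists_dyadic_scale {s : ℝ} {m : ℕ} (hs : ((2 : ℝ) ^ m)⁻¹ ≤ s) (hs' : s < 1) :
    ∃ j ≤ m, ((2 : ℝ) ^ j)⁻¹ ≤ s ∧ 2 ^ j * s < 2 := by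
  induction m with
  | zero => norm_num at hs; linarith
  | succ m ih =>
    by_cases hsm : ((2 : ℝ) ^ m)⁻¹ ≤ s
    · obtain ⟨j, hj, hjs⟩ := ih hsm
      exact ⟨j, by omega, hjs⟩
    · refine ⟨m + 1, le_rfl, hs, ?_⟩
      have h2 : (0 : ℝ) < 2 ^ m := by positivity
      have := mul_lt_mul_of_pos_left (not_le.mp hsm) h2
      rw [mul_inv_cancel₀ h2.ne'] at this
      rw [pow_succ]
      linarith

/-- The index in `{0, …, N - 1}` closest to the integer `q + t`. -/
def clampedIndex (N : ℕ) (q : ℤ) (t : Fin 3) : ℕ := min (q + (t : ℕ)).toNat (N - 1)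

/-- An interval `[a, a + s]` with `N s < 2` meets `[0, 1]` only inside three intervals of the
subdivision of `[0, 1]` into `N` equal parts. -/
theorem exists_clampedIndex_mem {N : ℕ} (hN : 0 < N) {a s x : ℝ} (hs : N * s < 2)
    (hx : x ∈ Set.Icc a (a + s)) (hx' : x ∈ Set.Icc (0 : ℝ) 1) :
    ∃ t : Fin 3, x ∈ Set.Icc ((clampedIndex N ⌊N * a⌋ t : ℝ) / N)
      (((clampedIndex N ⌊N * a⌋ t : ℝ) + 1) / N) := by
  have hN' : (0 : ℝ) < N := by exact_mod_cast hN
  have hlow : ⌊N * a⌋ ≤ ⌊N * x⌋ := Int.floor_mono (by nlinarith [hx.1])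
  have hupp : ⌊N * x⌋ < ⌊N * a⌋ + 3 := by
    rw [Int.floor_lt]
    push_cast
    nlinarith [hx.2, Int.lt_floor_add_one (N * a)]
  have hpos : 0 ≤ ⌊N * x⌋ := Int.floor_nonneg.mpr (mul_nonneg hN'.le hx'.1)
  obtain ⟨p, hp⟩ := Int.eq_ofNat_of_zero_le hpos
  refine ⟨⟨(⌊N * x⌋ - ⌊N * a⌋).toNat, by omega⟩, ?_⟩
  have hk : clampedIndex N ⌊N * a⌋ ⟨(⌊N * x⌋ - ⌊N * a⌋).toNat, by omega⟩ = min p (N - 1) := by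
    simp only [clampedIndex]
    omega
  have hfl := Int.floor_le (N * x)
  have hfl' := Int.lt_floor_add_one (N * x)
  rw [hp] at hfl hfl'
  push_cast at hfl hfl'
  rw [hk, Set.mem_Icc, div_le_iff₀ hN', le_div_iff₀ hN']
  rcases le_total p (N - 1) with hpN | hpN
  · rw [min_eq_left hpN]
    constructor <;> linarith
  · rw [min_eq_right hpN, Nat.cast_sub hN]
    have : ((N - 1 : ℕ) : ℝ) ≤ p := by exact_mod_cast hpN
    rw [Nat.cast_sub hN] at this
    push_cast at this ⊢
    constructor <;> nlinarith [hx'.2]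

/-- A cube of side length `s` with `2^j s < 2` meets the unit cube only inside the union of `3^n`
dyadic cubes of generation `j`. -/
theorem exists_dyadicCube_cover {n : ℕ} (a : Fin n → ℝ) {s : ℝ} {j : ℕ} (hs : 2 ^ j * s < 2) :
    ∃ d : (Fin n → Fin 3) → Set (Fin n → ℝ), (∀ t, IsDyadicCube j (d t)) ∧
      (Set.univ.pi fun i => Set.Icc (a i) (a i + s)) ∩ unitCube n ⊆ ⋃ t, d t := by
  have hN : 0 < 2 ^ j := by positivity
  refine ⟨fun t => Set.univ.pi fun i =>
    Set.Icc ((clampedIndex (2 ^ j) ⌊2 ^ j * a i⌋ (t i) : ℝ) / 2 ^ j)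
      (((clampedIndex (2 ^ j) ⌊2 ^ j * a i⌋ (t i) : ℝ) + 1) / 2 ^ j), fun t => ?_, ?_⟩
  · exact ⟨fun i => clampedIndex (2 ^ j) ⌊2 ^ j * a i⌋ (t i),
      fun i => (min_le_right _ _).trans_lt (Nat.sub_lt hN one_pos), rfl⟩
  · rintro x ⟨hxc, hxu⟩
    have hex := fun i => exists_clampedIndex_mem hN (a := a i) (s := s) (by exact_mod_cast hs)
      (hxc i trivial) (hxu i trivial)
    push_cast at hex
    choose t ht using hex
    exact Set.mem_iUnion.mpr ⟨t, fun i _ => ht i⟩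

/-- If `f` vanishes outside `[0,1]^n`, is a.e. bounded by
`2^{nm} h(2^{-nm})`, and satisfies `∫_d f ≤ h(V_n(d))` for every dyadic cube of
generation `≤ m`, then `∫_c f ≤ 3^n h(V_n(c))` for every cube `c`. -/
theorem cube_bound_from_dyadic {n : ℕ} (hn : 1 ≤ n) (h : ℝ → ℝ) (hg : IsGauge h)
    (m : ℕ) (hm : 0 < m) (f : (Fin n → ℝ) → NNReal) (hf : Measurable f)
    (hsupp : ∀ x, x ∉ unitCube n → f x = 0)
    (hbd : ∀ᵐ x ∂volume, (f x : ℝ) ≤ (2 : ℝ) ^ (n * m) * h (((2 : ℝ) ^ (n * m))⁻¹))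
    (hdyadic : ∀ j ≤ m, ∀ d : Set (Fin n → ℝ), IsDyadicCube j d →
      ∫⁻ x in d, (f x : ENNReal) ≤ ENNReal.ofReal (h (volume d).toReal)) :
    ∀ c : Set (Fin n → ℝ), IsCube c →
      ∫⁻ x in c, (f x : ENNReal) ≤ (3 : ENNReal) ^ n * ENNReal.ofReal (h (volume c).toReal) := by
  rintro c ⟨a, s, hs, rfl⟩
  have hc := measurableSet_pi_Icc a fun i => a i + s
  have hsupp' : ∀ x ∉ unitCube n, (f x : ENNReal) = 0 := fun x hx => by simp [hsupp x hx]
  rw [toReal_volume_pi_Icc_add a hs.le]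
  have hthree : (1 : ENNReal) ≤ 3 ^ n := one_le_pow₀ (by norm_num)
  have hmono : ∀ {r : ℝ}, 0 ≤ r → r ≤ s →
      ENNReal.ofReal (h (r ^ n)) ≤ ENNReal.ofReal (h (s ^ n)) := fun hr hrs =>
    ENNReal.ofReal_le_ofReal <| hg.mono (pow_nonneg hr n) (pow_nonneg hs.le n)
      (pow_le_pow_left₀ hr hrs n)
  rcases le_or_gt 1 s with hs1 | hs1
  · have hunit := isDyadicCube_unitCube n
    calc ∫⁻ x in Set.univ.pi fun i => Set.Icc (a i) (a i + s), (f x : ENNReal)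
        ≤ ∫⁻ x in unitCube n, (f x : ENNReal) :=
          setLIntegral_mono_of_inter_subset hc hunit.measurableSet hsupp' Set.inter_subset_right
      _ ≤ ENNReal.ofReal (h (1 ^ n)) := by
          simpa [hunit.toReal_volume] using hdyadic 0 m.zero_le _ hunit
      _ ≤ ENNReal.ofReal (h (s ^ n)) := hmono zero_le_one hs1
      _ ≤ 3 ^ n * ENNReal.ofReal (h (s ^ n)) := le_mul_of_one_le_left' hthree
  rcases le_or_gt ((2 : ℝ) ^ m)⁻¹ s with hsm | hsm
  · obtain ⟨j, hjm, hjs, hjs'⟩ := exists_dyadic_scale hsm hs1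
    obtain ⟨d, hd, hcover⟩ := exists_dyadicCube_cover a hjs'
    calc ∫⁻ x in Set.univ.pi fun i => Set.Icc (a i) (a i + s), (f x : ENNReal)
        ≤ ∫⁻ x in ⋃ t, d t, (f x : ENNReal) :=
          setLIntegral_mono_of_inter_subset hc
            (MeasurableSet.iUnion fun t => (hd t).measurableSet) hsupp' hcover
      _ ≤ ∑' t, ∫⁻ x in d t, (f x : ENNReal) := lintegral_iUnion_le _ _
      _ = ∑ t, ∫⁻ x in d t, (f x : ENNReal) := tsum_fintype _
      _ ≤ ∑ _t : Fin n → Fin 3, ENNReal.ofReal (h (s ^ n)) := by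
          refine Finset.sum_le_sum fun t _ => (hdyadic j hjm _ (hd t)).trans ?_
          rw [(hd t).toReal_volume]
          exact hmono (by positivity) hjs
      _ = 3 ^ n * ENNReal.ofReal (h (s ^ n)) := by simp
  · set M := (2 : ℝ) ^ (n * m) * h (((2 : ℝ) ^ (n * m))⁻¹)
    have hsn : s ^ n ≤ ((2 : ℝ) ^ (n * m))⁻¹ := by
      rw [mul_comm n m, pow_mul, ← inv_pow]
      exact pow_le_pow_left₀ hs.le hsm.le n
    have hr1 : M * s ^ n ≤ h (s ^ n) := by
      have := hg.r1 (pow_pos hs n) hsn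
      rwa [div_inv_eq_mul, mul_comm, le_div_iff₀ (pow_pos hs n)] at this
    calc ∫⁻ x in Set.univ.pi fun i => Set.Icc (a i) (a i + s), (f x : ENNReal)
        ≤ ∫⁻ _ in Set.univ.pi fun i => Set.Icc (a i) (a i + s), ENNReal.ofReal M := by
          refine lintegral_mono_ae (ae_restrict_of_ae (hbd.mono fun x hx => ?_))
          rw [← ENNReal.ofReal_coe_nnreal]
          exact ENNReal.ofReal_le_ofReal hx
      _ = ENNReal.ofReal (M * s ^ n) := by
          rw [setLIntegral_const, volume_pi_Icc_add, ← ENNReal.ofReal_pow hs.le,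
            ENNReal.ofReal_mul' (p := M) (pow_nonneg hs.le n)]
      _ ≤ ENNReal.ofReal (h (s ^ n)) := ENNReal.ofReal_le_ofReal hr1
      _ ≤ 3 ^ n * ENNReal.ofReal (h (s ^ n)) := le_mul_of_one_le_left' hthree
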